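/- For every n ≥ 1 and every q with 1 ≤ q < r_n, the consecutive Schröder paths 𝒮_n(q) and 𝒮_n(q+1) differ in at most 5 places, i.e. d(𝒮_n(q), 𝒮_n(q+1)) ≤ 5. -/

import Mathlib

/-- Steps of a Schröder path: `u = (1,1)`, `d = (1,-1)`, `e = (2,0)`. -/
inductive Step : Type
  | u : Step
  | d : Step
  | e : Step
deriving DecidableEq, Repr

/-- The large Schröder numbers: `r 0 = 1` and
`r n = r (n-1) + ∑_{k=1}^{n} r (k-1) * r (n-k)` for `n > 0`. -/
def schroder : ℕ → ℕ
  | 0 => 1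
  | n + 1 =>
    schroder n + ∑ k ∈ (Finset.range (n + 1)).attach, schroder k.1 * schroder (n - k.1)
decreasing_by
  · omega
  · have := k.2; simp only [Finset.mem_range] at this; omega
  · omega

/-- `B 1 = 0` and `B i = r_0 + ⋯ + r_{i-2}` for `i > 1`. -/
def B (i : ℕ) : ℕ := ∑ m ∈ Finset.range (i - 1), schroder m

/-- `L^i`: the list `L` if `i` is odd, `L` reversed if `i` is even. -/
def altS (L : List (List Step)) (i : ℕ) : List (List Step) :=
  if i % 2 = 1 then L else L.reverse

/-- `L(j)`: the `j`-th entry of the list `L` (entries numbered from 1). -/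
def entS (L : List (List Step)) (j : ℕ) : List Step := L.getD (j - 1) []

/-- The recursively defined list `𝒮_n` of Schröder paths: `𝒮_0` consists of the empty
path, and `𝒮_n` is the concatenation of `e⬝𝒮_{n-1}(i)` for `i = 1,…,r_{n-1}` followed by,
for `i = 1,…,n`, `j = 1,…,r_{i-1}`, `k = 1,…,r_{n-i}`, the path
`u⬝𝒮_{i-1}^{n+i}(j)⬝d⬝𝒮_{n-i}^{j+B(i)+1}(k)`. -/
def Slist : ℕ → List (List Step)
  | 0 => [[]]
  | n + 1 =>
    ((Slist n).map fun p => Step.e :: p) ++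
      ((List.range (n + 1)).attach.flatMap fun i =>
        (List.range (schroder i.1)).flatMap fun j =>
          (List.range (schroder (n - i.1))).flatMap fun k =>
            [Step.u :: entS (altS (Slist i.1) (n + 1 + (i.1 + 1))) (j + 1) ++
              Step.d :: entS (altS (Slist (n - i.1)) (j + 1 + B (i.1 + 1) + 1)) (k + 1)])
decreasing_by
  · omega
  · have := i.2; simp only [List.mem_range] at this; omega
  · omega

/-- Expand a path by replacing every level step `e = (2,0)` by two unit level steps. -/
def expand (p : List Step) : List Step :=
  p.flatMap fun s => match s with
    | Step.e => [Step.e, Step.e]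
    | s => [s]

/-- `d(p₁,p₂)`: the number of places in which two Schröder paths differ when every
step `e` is replaced by two unit level steps. -/
def dpath (p q : List Step) : ℕ :=
  (((expand p).zip (expand q)).filter fun x => x.1 != x.2).length

/-- The vertical displacement of a step. -/
def ycost : Step → ℤ
  | Step.u => 1
  | Step.d => -1
  | Step.e => 0

/-- The horizontal displacement of a step. -/
def xcost : Step → ℕ
  | Step.u => 1
  | Step.d => 1
  | Step.e => 2

/-- `p` is a Schröder path of length `n`: it goes from `(0,0)` to `(2n,0)` and never
goes below the `x`-axis. -/
def IsSchroder (n : ℕ) (p : List Step) : Prop :=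
  (p.map xcost).sum = 2 * n ∧ (p.map ycost).sum = 0 ∧
    ∀ q : List Step, q <+: p → 0 ≤ (q.map ycost).sum

/-- Two paths of the same width differing in at most 5 places. -/
def Near (p q : List Step) : Prop :=
  (expand p).length = (expand q).length ∧ dpath p q ≤ 5

theorem expand_append (p q : List Step) : expand (p ++ q) = expand p ++ expand q := by
  simp [expand]

theorem dpath_self (p : List Step) : dpath p p = 0 := by
  unfold dpath
  induction expand p with
  | nil => rfl
  | cons a l ih => simpa using ih

theorem dpath_comm (p q : List Step) : dpath p q = dpath q p := by
  unfold dpath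
  rw [← List.zip_swap, List.filter_map, List.length_map]
  congr 2
  funext x
  simp [bne_comm]

theorem dpath_append {p p' : List Step} (q q' : List Step)
    (h : (expand p).length = (expand p').length) :
    dpath (p ++ q) (p' ++ q') = dpath p p' + dpath q q' := by
  simp [dpath, expand_append, List.zip_append h]

theorem Near.symm {p q : List Step} (h : Near p q) : Near q p :=
  ⟨h.1.symm, dpath_comm p q ▸ h.2⟩

theorem Near.append {p q : List Step} (h : Near p q) (l r : List Step) :
    Near (l ++ p ++ r) (l ++ q ++ r) := by
  refine ⟨by simp [expand_append, h.1], ?_⟩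
  rw [dpath_append _ _ (by simp [expand_append, h.1]), dpath_append _ _ rfl, dpath_self, dpath_self]
  simpa using h.2

theorem near_of_eq_append {p q : List Step} (l x y r : List Step) (h : Near x y)
    (hp : p = l ++ x ++ r) (hq : q = l ++ y ++ r) : Near p q := by
  subst hp hq
  exact h.append l r

/-- The last path of `Slist n`. -/
def finalPath : ℕ → List Step
  | 0 => []
  | n + 1 => Step.u :: List.replicate n Step.e ++ [Step.d]

/-- The first path of `altS (Slist n) p`. -/
def endPath (n p : ℕ) : List Step :=
  if p % 2 = 1 then List.replicate n Step.e else finalPath n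

theorem endPath_congr (n : ℕ) {p q : ℕ} (h : p % 2 = q % 2) : endPath n p = endPath n q := by
  simp [endPath, h]

theorem near_endPath (i m a b : ℕ) :
    Near (Step.u :: endPath i a ++ Step.d :: endPath (m + 1) b)
      (Step.u :: endPath (i + 1) a ++ Step.d :: endPath m b) := by
  unfold endPath
  split_ifs
  · exact near_of_eq_append (Step.u :: List.replicate i Step.e) [Step.d, Step.e] [Step.e, Step.d]
      (List.replicate m Step.e) (by unfold Near; decide)
      (by simp [List.replicate_succ]) (by simp [List.replicate_succ'])
  · cases m with
    | zero =>
      exact near_of_eq_append (Step.u :: List.replicate i Step.e)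
        [Step.d, Step.u, Step.d] [Step.e, Step.d] [] (by unfold Near; decide)
        (by simp [finalPath]) (by simp [List.replicate_succ', finalPath])
    | succ m =>
      exact near_of_eq_append (Step.u :: List.replicate i Step.e)
        [Step.d, Step.u, Step.e] [Step.e, Step.d, Step.u] (List.replicate m Step.e ++ [Step.d])
        (by unfold Near; decide)
        (by simp [finalPath, List.replicate_succ]) (by simp [List.replicate_succ', finalPath])
  · cases i with
    | zero =>
      exact near_of_eq_append [Step.u] [Step.d, Step.e] [Step.u, Step.d, Step.d]
        (List.replicate m Step.e) (by unfold Near; decide)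
        (by simp [finalPath, List.replicate_succ]) (by simp [finalPath])
    | succ i =>
      exact near_of_eq_append (Step.u :: Step.u :: List.replicate i Step.e)
        [Step.d, Step.d, Step.e] [Step.e, Step.d, Step.d]
        (List.replicate m Step.e) (by unfold Near; decide)
        (by simp [finalPath, List.replicate_succ]) (by simp [finalPath, List.replicate_succ'])
  · cases i with
    | zero =>
      cases m with
      | zero => unfold Near; decide
      | succ m =>
        exact near_of_eq_append [Step.u] [Step.d, Step.u, Step.e]
          [Step.u, Step.d, Step.d, Step.u]
          (List.replicate m Step.e ++ [Step.d]) (by unfold Near; decide)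
          (by simp [finalPath, List.replicate_succ]) (by simp [finalPath])
    | succ i =>
      cases m with
      | zero =>
        exact near_of_eq_append (Step.u :: Step.u :: List.replicate i Step.e)
          [Step.d, Step.d, Step.u, Step.d] [Step.e, Step.d, Step.d] [] (by unfold Near; decide)
          (by simp [finalPath]) (by simp [finalPath, List.replicate_succ'])
      | succ m =>
        exact near_of_eq_append (Step.u :: Step.u :: List.replicate i Step.e)
          [Step.d, Step.d, Step.u, Step.e] [Step.e, Step.d, Step.d, Step.u]
          (List.replicate m Step.e ++ [Step.d]) (by unfold Near; decide)
          (by simp [finalPath, List.replicate_succ]) (by simp [finalPath, List.replicate_succ'])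

theorem schroder_succ (n : ℕ) :
    schroder (n + 1) = schroder n + ∑ k ∈ Finset.range (n + 1), schroder k * schroder (n - k) := by
  rw [schroder, Finset.sum_attach (Finset.range (n + 1)) fun k => schroder k * schroder (n - k)]

theorem schroder_pos (n : ℕ) : 0 < schroder n := by
  induction n with
  | zero => simp [schroder]
  | succ n ih => rw [schroder_succ]; omega

theorem B_succ (i : ℕ) : B (i + 1 + 1) = B (i + 1) + schroder i := by
  simp [B, Finset.sum_range_succ]

theorem length_altS (L : List (List Step)) (i : ℕ) : (altS L i).length = L.length := by
  unfold altS
  split_ifs <;> simp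

theorem map_entS_range (L : List (List Step)) :
    ((List.range L.length).map fun k => entS L (k + 1)) = L := by
  refine List.ext_getElem (by simp) fun i h _ => ?_
  have h' : i < L.length := by simpa using h
  simp [entS, h']

section FlatMapRange

variable {α : Type*} (f : ℕ → List α)

theorem head?_flatMap_range {m : ℕ} {x : α} (hm : 0 < m) (h : (f 0).head? = some x) :
    ((List.range m).flatMap f).head? = some x := by
  obtain ⟨m, rfl⟩ := Nat.exists_eq_succ_of_ne_zero hm.ne'
  simp [List.range_succ_eq_map, List.head?_append, h]

theorem getLast?_flatMap_range {m : ℕ} {x : α} (h : (f m).getLast? = some x) :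
    ((List.range (m + 1)).flatMap f).getLast? = some x := by
  simp [List.range_succ, List.getLast?_append, h]

theorem isChain_flatMap_range {R : α → α → Prop} {m : ℕ} (a b : ℕ → α)
    (hf : ∀ i < m, (f i).IsChain R) (ha : ∀ i < m, (f i).head? = some (a i))
    (hb : ∀ i < m, (f i).getLast? = some (b i)) (hab : ∀ i, i + 1 < m → R (b i) (a (i + 1))) :
    ((List.range m).flatMap f).IsChain R := by
  induction m with
  | zero => simp
  | succ m ih =>
    rw [List.range_succ, List.flatMap_append, List.isChain_append]
    refine ⟨ih (fun i hi => hf i (by omega)) (fun i hi => ha i (by omega))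
      (fun i hi => hb i (by omega)) (fun i hi => hab i (by omega)),
      by simpa using hf m (by omega), ?_⟩
    cases m with
    | zero => simp
    | succ m =>
      rw [getLast?_flatMap_range f (hb m (by omega))]
      simpa [ha (m + 1) (by omega)] using hab m (by omega)

end FlatMapRange

/-- The paths of `Slist (n + 1)` that return to the axis for the first time after
`i + 1` units, the inner path being the `j`-th one (from 0). -/
def innerBlock (n i j : ℕ) : List (List Step) :=
  (altS (Slist (n - i)) (j + 1 + B (i + 1) + 1)).map fun q =>
    Step.u :: entS (altS (Slist i) (n + 1 + (i + 1))) (j + 1) ++ Step.d :: q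

/-- The paths of `Slist (n + 1)` that return to the axis for the first time after
`i + 1` units. -/
def outerBlock (n i : ℕ) : List (List Step) :=
  (List.range (schroder i)).flatMap (innerBlock n i)

/-- The properties of `Slist n` carried through the induction. -/
structure GoodList (n : ℕ) : Prop where
  length : (Slist n).length = schroder n
  chain : (Slist n).IsChain Near
  head : (Slist n).head? = some (List.replicate n Step.e)
  last : (Slist n).getLast? = some (finalPath n)

theorem Slist_succ (n : ℕ) (h : ∀ i ≤ n, GoodList i) :
    Slist (n + 1) =
      ((Slist n).map fun p => Step.e :: p) ++ (List.range (n + 1)).flatMap (outerBlock n) := by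
  rw [Slist]
  congr 1
  conv_rhs => rw [← List.attach_map_subtype_val (List.range (n + 1)), List.flatMap_map]
  congr 1
  funext i
  unfold outerBlock
  congr 1
  funext j
  have hl : schroder (n - i.1) =
      (altS (Slist (n - i.1)) (j + 1 + B (i.1 + 1) + 1)).length := by
    rw [length_altS, (h (n - i.1) (by omega)).length]
  unfold innerBlock
  conv_rhs => rw [← map_entS_range (altS (Slist (n - i.1)) (j + 1 + B (i.1 + 1) + 1)), ← hl]
  simp [← List.map_eq_flatMap, Function.comp_def]

namespace GoodList

variable {n : ℕ}

theorem chain_altS (h : GoodList n) (p : ℕ) : (altS (Slist n) p).IsChain Near := by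
  unfold altS
  split_ifs
  · exact h.chain
  · rw [List.isChain_reverse]
    exact h.chain.imp fun _ _ => Near.symm

theorem head_altS (h : GoodList n) (p : ℕ) :
    (altS (Slist n) p).head? = some (endPath n p) := by
  unfold altS endPath
  split_ifs
  · exact h.head
  · rw [List.head?_reverse, h.last]

theorem last_altS (h : GoodList n) (p : ℕ) :
    (altS (Slist n) p).getLast? = some (endPath n (p + 1)) := by
  unfold altS endPath
  split_ifs
  · omega
  · exact h.last
  · rw [List.getLast?_reverse, h.head]
  · omega

theorem entS_altS_first (h : GoodList n) (p : ℕ) :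
    entS (altS (Slist n) p) 1 = endPath n p := by
  have := h.head_altS p
  rw [List.head?_eq_getElem?] at this
  simp [entS, this]

theorem entS_altS_last (h : GoodList n) (p : ℕ) :
    entS (altS (Slist n) p) (schroder n) = endPath n (p + 1) := by
  have := h.last_altS p
  rw [List.getLast?_eq_getElem?, length_altS, h.length] at this
  simp [entS, this]

theorem near_entS_altS (h : GoodList n) (p : ℕ) {j : ℕ} (hj : j + 1 < schroder n) :
    Near (entS (altS (Slist n) p) (j + 1)) (entS (altS (Slist n) p) (j + 1 + 1)) := by
  have hl : (altS (Slist n) p).length = schroder n := by rw [length_altS, h.length]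
  have := List.isChain_iff_getElem.1 (h.chain_altS p) j (by omega)
  have h0 : j < (altS (Slist n) p).length := by omega
  have h1 : j + 1 < (altS (Slist n) p).length := by omega
  simpa [entS, h0, h1] using this

end GoodList

section Blocks

variable {n i : ℕ}

theorem length_outerBlock (h : GoodList (n - i)) :
    (outerBlock n i).length = schroder i * schroder (n - i) := by
  simp [outerBlock, innerBlock, List.length_flatMap, length_altS, h.length]

theorem head?_innerBlock (h : GoodList (n - i)) (j : ℕ) :
    (innerBlock n i j).head? =
      some (Step.u :: entS (altS (Slist i) (n + 1 + (i + 1))) (j + 1) ++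
        Step.d :: endPath (n - i) (j + B (i + 1))) := by
  rw [innerBlock, List.head?_map, h.head_altS, Option.map_some,
    endPath_congr (q := j + B (i + 1)) _ (by omega)]

theorem getLast?_innerBlock (h : GoodList (n - i)) (j : ℕ) :
    (innerBlock n i j).getLast? =
      some (Step.u :: entS (altS (Slist i) (n + 1 + (i + 1))) (j + 1) ++
        Step.d :: endPath (n - i) (j + 1 + B (i + 1))) := by
  rw [innerBlock, List.getLast?_map, h.last_altS, Option.map_some,
    endPath_congr (q := j + 1 + B (i + 1)) _ (by omega)]

theorem head?_outerBlock (hi : GoodList i) (h : GoodList (n - i)) :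
    (outerBlock n i).head? =
      some (Step.u :: endPath i (n + i) ++ Step.d :: endPath (n - i) (B (i + 1))) := by
  refine head?_flatMap_range _ (schroder_pos i) ?_
  rw [head?_innerBlock h, hi.entS_altS_first, endPath_congr (q := n + i) _ (by omega), zero_add]

theorem getLast?_outerBlock (hi : GoodList i) (h : GoodList (n - i)) :
    (outerBlock n i).getLast? =
      some (Step.u :: endPath i (n + i + 1) ++
        Step.d :: endPath (n - i) (B (i + 1 + 1))) := by
  have hs : schroder i - 1 + 1 = schroder i := Nat.sub_add_cancel (schroder_pos i)
  rw [outerBlock, ← hs]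
  refine getLast?_flatMap_range _ ?_
  rw [getLast?_innerBlock h, hs, hi.entS_altS_last,
    endPath_congr (q := n + i + 1) _ (by omega), B_succ, add_comm (schroder i)]

theorem isChain_innerBlock (h : GoodList (n - i)) (j : ℕ) :
    (innerBlock n i j).IsChain Near := by
  rw [innerBlock, List.isChain_map]
  refine (h.chain_altS _).imp fun p q hpq => ?_
  exact near_of_eq_append
    (Step.u :: entS (altS (Slist i) (n + 1 + (i + 1))) (j + 1) ++ [Step.d]) p q [] hpq
    (by simp) (by simp)

theorem isChain_outerBlock (hi : GoodList i) (h : GoodList (n - i)) :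
    (outerBlock n i).IsChain Near := by
  refine isChain_flatMap_range _ _ _ (fun j _ => isChain_innerBlock h j)
    (fun j _ => head?_innerBlock h j) (fun j _ => getLast?_innerBlock h j) fun j hj => ?_
  exact near_of_eq_append [Step.u] _ _ _ (hi.near_entS_altS _ hj) rfl rfl

end Blocks

theorem goodList_succ {n : ℕ} (h : ∀ i ≤ n, GoodList i) : GoodList (n + 1) := by
  have hn := h n le_rfl
  have hsub : ∀ i, GoodList (n - i) := fun i => h _ (by omega)
  have hhead := head?_outerBlock (h 0 (by omega)) (hsub 0)
  refine ⟨?_, ?_, ?_, ?_⟩ <;> rw [Slist_succ n h]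
  · rw [List.length_append, List.length_map, hn.length, schroder_succ, List.length_flatMap,
      Finset.sum_range, ← List.sum_ofFn]
    congr 2
    refine List.ext_getElem (by simp) fun i _ _ => ?_
    simp [length_outerBlock (hsub i), -List.ofFn_succ]
  · refine List.isChain_append.2 ⟨?_, ?_, ?_⟩
    · rw [List.isChain_map]
      exact hn.chain.imp fun p q hpq =>
        near_of_eq_append [Step.e] p q [] hpq (by simp) (by simp)
    · refine isChain_flatMap_range _ _ _
        (fun i hi => isChain_outerBlock (h i (by omega)) (hsub i))
        (fun i hi => head?_outerBlock (h i (by omega)) (hsub i))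
        (fun i hi => getLast?_outerBlock (h i (by omega)) (hsub i)) fun i hi => ?_
      rw [show n - i = n - (i + 1) + 1 by omega]
      exact near_endPath _ _ _ _
    · rw [List.getLast?_map, hn.last, head?_flatMap_range _ (by omega) hhead]
      simp only [Option.map_some, Option.mem_some_iff, forall_eq']
      exact near_of_eq_append [] [Step.e] [Step.u, Step.d] (finalPath n) (by unfold Near; decide)
        rfl (by simp [endPath, finalPath, B])
  · simp [List.head?_append, hn.head, List.replicate_succ]
  · rw [List.getLast?_append, getLast?_flatMap_range _ (getLast?_outerBlock hn (hsub n))]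
    have : (n + n + 1) % 2 = 1 := by omega
    simp [endPath, finalPath, this]

theorem goodList (n : ℕ) : GoodList n := by
  induction n using Nat.strong_induction_on with
  | _ n ih =>
    cases n with
    | zero => constructor <;> simp [Slist, schroder, finalPath]
    | succ n => exact goodList_succ fun i hi => ih i (by omega)

/-- Consecutive Schröder paths in the list `𝒮_n` differ in at most 5 places. -/
theorem Slist_consecutive_dpath_le_five :
    ∀ n : ℕ, 1 ≤ n → ∀ q : ℕ, 1 ≤ q → q < schroder n →
      dpath (entS (Slist n) q) (entS (Slist n) (q + 1)) ≤ 5 := by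
  intro n _ q hq hqn
  obtain ⟨q, rfl⟩ := Nat.exists_eq_add_of_le' hq
  exact ((goodList n).near_entS_altS 1 hqn).2
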